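/- For every ε ∈ [0,1/2] and every Condorcet-consistent tournament rule r, α₂^r(𝒯^ε) ≥ ε/3 + 2ε²/3. Concretely, there exist a weakly ε-bounded independent probabilistic tournament T on 3 teams, a pair S of its teams, and a tournament T' that is S-adjacent to T, such that r_S(T') − r_S(T) ≥ ε/3 + 2ε²/3. -/

import Mathlib

open scoped Classical
open Finset

/-! ## Basic tournament notions -/

/-- The set of potential matches among `n` teams: ordered pairs `(i, j)` with `i < j`. -/
abbrev MatchPair (n : ℕ) := {q : Fin n × Fin n // q.1 < q.2}

/-- A deterministic (round robin) tournament on `n` teams: for each pair `i < j`,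
`true` means that `i` beats `j`. -/
abbrev Outcome (n : ℕ) := MatchPair n → Bool

/-- `Outcome.beats o i j` holds when team `i` beats team `j` (it is `false` when `i = j`). -/
def Outcome.beats {n : ℕ} (o : Outcome n) (i j : Fin n) : Bool :=
  if h : i < j then o ⟨(i, j), h⟩
  else if h' : j < i then !o ⟨(j, i), h'⟩
  else false

/-- An independent probabilistic tournament on `n` teams: `p i j` is the probability
that `i` beats `j`, with `p i j + p j i = 1` for `i ≠ j`. -/
structure ProbTournament (n : ℕ) where
  p : Fin n → Fin n → ℝ
  mem_Icc : ∀ i j : Fin n, p i j ∈ Set.Icc (0 : ℝ) 1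
  compl : ∀ i j : Fin n, i ≠ j → p i j + p j i = 1

/-- The probability of the deterministic outcome `o` when all matches are independent
with probabilities given by `T`. -/
noncomputable def ProbTournament.prob {n : ℕ} (T : ProbTournament n) (o : Outcome n) : ℝ :=
  ∏ e : MatchPair n, (if o e then T.p e.val.1 e.val.2 else T.p e.val.2 e.val.1)

/-- `rP r T i`: the probability that team `i` wins when rule `r` is applied to the
independent probabilistic tournament `T`. -/
noncomputable def rP (r : ∀ n : ℕ, Outcome n → Fin n → ℝ) {n : ℕ}
    (T : ProbTournament n) (i : Fin n) : ℝ :=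
  ∑ o : Outcome n, T.prob o * r n o i

/-- `rPS r T S`: the probability that the winner lies in `S`. -/
noncomputable def rPS (r : ∀ n : ℕ, Outcome n → Fin n → ℝ) {n : ℕ}
    (T : ProbTournament n) (S : Finset (Fin n)) : ℝ :=
  ∑ i ∈ S, rP r T i

/-- A tournament rule assigns a probability distribution over the teams to every
deterministic tournament. -/
def IsTournamentRule (r : ∀ n : ℕ, Outcome n → Fin n → ℝ) : Prop :=
  (∀ (n : ℕ) (o : Outcome n) (i : Fin n), 0 ≤ r n o i) ∧
  (∀ n : ℕ, 0 < n → ∀ o : Outcome n, ∑ i : Fin n, r n o i = 1)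

/-- A rule is Condorcet-consistent if an undefeated team wins with probability 1. -/
def CondorcetConsistent (r : ∀ n : ℕ, Outcome n → Fin n → ℝ) : Prop :=
  ∀ (n : ℕ) (o : Outcome n) (i : Fin n),
    (∀ j : Fin n, j ≠ i → Outcome.beats o i j = true) → r n o i = 1

/-- Two independent probabilistic tournaments are `S`-adjacent if they agree on every
match that is not between two members of `S`. -/
def Adjacent {n : ℕ} (S : Finset (Fin n)) (T T' : ProbTournament n) : Prop :=
  ∀ i j : Fin n, ¬(i ∈ S ∧ j ∈ S) → T.p i j = T'.p i j

/-- Weakly ε-bounded: all match probabilities lie in `[1/2 - ε, 1/2 + ε]`. -/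
def WeaklyBounded (ε : ℝ) (n : ℕ) (T : ProbTournament n) : Prop :=
  ∀ i j : Fin n, i ≠ j → T.p i j ∈ Set.Icc (1/2 - ε) (1/2 + ε)

/-- Strictly ε-bounded: all match probabilities lie in `{1/2 - ε, 1/2 + ε}`. -/
def StrictlyBounded (ε : ℝ) (n : ℕ) (T : ProbTournament n) : Prop :=
  ∀ i j : Fin n, i ≠ j → T.p i j = 1/2 - ε ∨ T.p i j = 1/2 + ε

/-- `alph r k C`: the manipulability `α_k^r(C)`, i.e. the supremum over tournaments in the
class `C` (on any number of teams), sets `S` of at most `k` teams, and `S`-adjacent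
manipulations `T'`, of the gain `r_S(T') - r_S(T)`. -/
noncomputable def alph (r : ∀ n : ℕ, Outcome n → Fin n → ℝ) (k : ℕ)
    (C : ∀ n : ℕ, ProbTournament n → Prop) : ℝ :=
  sSup {x : ℝ | ∃ (n : ℕ) (T T' : ProbTournament n) (S : Finset (Fin n)),
    C n T ∧ S.card ≤ k ∧ Adjacent S T T' ∧ x = rPS r T' S - rPS r T S}

/-! ## Anonymity -/

/-- The relabeling of an outcome by a permutation `σ`: in `permOutcome σ o`,
team `σ i` beats team `σ j` exactly when `i` beats `j` in `o`. -/
def permOutcome {n : ℕ} (σ : Equiv.Perm (Fin n)) (o : Outcome n) : Outcome n :=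
  fun e => Outcome.beats o (σ.symm e.val.1) (σ.symm e.val.2)

/-- A tournament rule is anonymous if relabeling the teams relabels the winner
distribution accordingly. -/
def IsAnonymous (r : ∀ n : ℕ, Outcome n → Fin n → ℝ) : Prop :=
  ∀ (n : ℕ) (σ : Equiv.Perm (Fin n)) (o : Outcome n) (i : Fin n),
    r n (permOutcome σ o) (σ i) = r n o i

/-! ## Elimination rules and recursive tournament rules -/

/-- An elimination rule: for every number `n > 1` of teams, a distribution `d n` over
sets `M` of matches to be played, with `1 ≤ |M| ≤ n - 1` on the support. -/
structure ElimRule where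
  d : ∀ n : ℕ, Finset (MatchPair n) → ℝ
  nonneg : ∀ (n : ℕ) (M : Finset (MatchPair n)), 0 ≤ d n M
  sum_one : ∀ n : ℕ, 1 < n → ∑ M : Finset (MatchPair n), d n M = 1
  supp : ∀ (n : ℕ) (M : Finset (MatchPair n)), 1 < n → d n M ≠ 0 →
    1 ≤ M.card ∧ M.card ≤ n - 1

/-- A set of matches is a matching when no team appears in two distinct matches. -/
def IsMatchingSet {n : ℕ} (M : Finset (MatchPair n)) : Prop :=
  ∀ e ∈ M, ∀ e' ∈ M, e ≠ e' →
    e.val.1 ≠ e'.val.1 ∧ e.val.1 ≠ e'.val.2 ∧ e.val.2 ≠ e'.val.1 ∧ e.val.2 ≠ e'.val.2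

/-- A matching elimination rule only ever selects matchings. -/
def ElimRule.IsMatchingRule (E : ElimRule) : Prop :=
  ∀ (n : ℕ) (M : Finset (MatchPair n)), E.d n M ≠ 0 → IsMatchingSet M

/-- Team `i` loses one of the matches in `M` under the outcome `o`. -/
def losesIn {n : ℕ} (o : Outcome n) (M : Finset (MatchPair n)) (i : Fin n) : Prop :=
  ∃ e ∈ M, (e.val.1 = i ∧ Outcome.beats o e.val.2 i = true) ∨
           (e.val.2 = i ∧ Outcome.beats o e.val.1 i = true)

/-- The teams surviving the matches `M` (i.e. not losing any match of `M`). -/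
noncomputable def survivors {n : ℕ} (o : Outcome n) (M : Finset (MatchPair n)) :
    Finset (Fin n) :=
  Finset.univ.filter (fun i => ¬ losesIn o M i)

/-- The induced sub-outcome on the teams of `s`, reindexed by `Fin s.card` in
increasing order. -/
noncomputable def restrictOutcome {n : ℕ} (o : Outcome n) (s : Finset (Fin n)) :
    Outcome s.card :=
  fun e => Outcome.beats o (↑(s.orderIsoOfFin rfl e.val.1)) (↑(s.orderIsoOfFin rfl e.val.2))

/-- The induced probabilistic subtournament on the teams of `s` (same match
probabilities), reindexed by `Fin s.card` in increasing order. -/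
noncomputable def restrictProb {n : ℕ} (T : ProbTournament n) (s : Finset (Fin n)) :
    ProbTournament s.card where
  p a b := T.p ↑(s.orderIsoOfFin rfl a) ↑(s.orderIsoOfFin rfl b)
  mem_Icc _ _ := T.mem_Icc _ _
  compl a b hab := T.compl _ _
    (fun h => hab ((s.orderIsoOfFin rfl).injective (Subtype.coe_injective h)))

/-- The subset of `Fin s.card` corresponding to the members of `S` that lie in `s`. -/
noncomputable def mapTeams {n : ℕ} (s : Finset (Fin n)) (S : Finset (Fin n)) :
    Finset (Fin s.card) :=
  Finset.univ.filter (fun a => (↑(s.orderIsoOfFin rfl a) : Fin n) ∈ S)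

/-- Fueled recursion computing the winner distribution of the recursive tournament rule
`r^E`: sample `M ← E(n)`, eliminate all losers of matches in `M`, recurse on survivors. -/
noncomputable def recWinAux (E : ElimRule) : ℕ → ∀ n : ℕ, Outcome n → Fin n → ℝ
  | 0, n, _, _ => if n = 1 then 1 else 0
  | fuel + 1, n, o, i =>
    if n ≤ 1 then (if n = 1 then 1 else 0)
    else ∑ M : Finset (MatchPair n), E.d n M *
      (if h : i ∈ survivors o M then
        recWinAux E fuel (survivors o M).card (restrictOutcome o (survivors o M))
          (((survivors o M).orderIsoOfFin rfl).symm ⟨i, h⟩)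
      else 0)

/-- The recursive tournament rule `r^E` determined by the elimination rule `E`. -/
noncomputable def recWin (E : ElimRule) : ∀ n : ℕ, Outcome n → Fin n → ℝ :=
  fun n => recWinAux E n n

/-- `matchMem M u v`: the match between `u` and `v` belongs to `M`. -/
def matchMem {n : ℕ} (M : Finset (MatchPair n)) (u v : Fin n) : Prop :=
  ∃ e ∈ M, e.val = (u, v) ∨ e.val = (v, u)

/-- `valAfter r T M S`: the expected probability that the winner lies in `S` when the
matches in `M` are played with outcomes drawn from `T`, the losers are eliminated, and
`r` is then run on the induced probabilistic subtournament `T|_M` of the survivors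
(with the convention that eliminated teams win with probability `0`). -/
noncomputable def valAfter (r : ∀ n : ℕ, Outcome n → Fin n → ℝ) {n : ℕ}
    (T : ProbTournament n) (M : Finset (MatchPair n)) (S : Finset (Fin n)) : ℝ :=
  ∑ o : Outcome n, T.prob o *
    rPS r (restrictProb T (survivors o M)) (mapTeams (survivors o M) S)

/-- `U` is a base case for the manipulating coalition `S` under rule `r`:
no `S`-adjacent manipulation gains anything, i.e. `α_S^r(U) = 0`. -/
def IsBaseCase (r : ∀ n : ℕ, Outcome n → Fin n → ℝ) {m : ℕ}
    (U : ProbTournament m) (S : Finset (Fin m)) : Prop :=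
  ∀ U' : ProbTournament m, Adjacent S U U' → rPS r U' S - rPS r U S ≤ 0

/-! ## Gauntlets -/

/-- The tournament obtained from `o` by letting `u` beat every other team, keeping all
other matches intact. -/
def condorcetify {n : ℕ} (o : Outcome n) (u : Fin n) : Outcome n :=
  fun e => if e.val.1 = u then true else if e.val.2 = u then false else o e

/-- The opponents of `u` among the matches in `M`. -/
noncomputable def opponents {n : ℕ} (M : Finset (MatchPair n)) (u : Fin n) :
    Finset (Fin n) :=
  (M.filter (fun e => e.val.1 = u)).image (fun e => e.val.2) ∪
  (M.filter (fun e => e.val.2 = u)).image (fun e => e.val.1)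

/-- Fueled recursion for the distribution of the gauntlet of `u`: the set of opponents
that `u` plays in elimination matches when `r^E` is executed on a tournament in which
`u` beats everybody (the input `o` is assumed already so modified).  The value is the
probability, over the internal randomness of `E`, that the gauntlet equals `g`
(recorded as a set of teams of the outermost tournament). -/
noncomputable def gauntletDistAux (E : ElimRule) :
    ℕ → ∀ n : ℕ, Outcome n → Fin n → Finset (Fin n) → ℝ
  | 0, _, _, _, g => if g = ∅ then 1 else 0
  | fuel + 1, n, o, u, g =>
    if n ≤ 1 then (if g = ∅ then 1 else 0)
    else ∑ M : Finset (MatchPair n), E.d n M *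
      (if h : u ∈ survivors o M ∧ opponents M u ⊆ g ∧ g \ opponents M u ⊆ survivors o M then
        gauntletDistAux E fuel (survivors o M).card (restrictOutcome o (survivors o M))
          (((survivors o M).orderIsoOfFin rfl).symm ⟨u, h.1⟩)
          (Finset.univ.filter (fun a =>
            (↑((survivors o M).orderIsoOfFin rfl a) : Fin n) ∈ g \ opponents M u))
      else 0)

/-- `gauntletDist E n o u g`: the probability that the gauntlet `G^{r^E}_u(o)` of team
`u` in the deterministic tournament `o` equals the set `g`. -/
noncomputable def gauntletDist (E : ElimRule) (n : ℕ) (o : Outcome n) (u : Fin n)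
    (g : Finset (Fin n)) : ℝ :=
  gauntletDistAux E n n (condorcetify o u) u g

/-- `gauntletProbP E T u g`: the probability that the gauntlet `G^{r^E}_u(T)` of team `u`
in the independent probabilistic tournament `T` equals the set `g` (first sampling a
deterministic tournament from `T`, then the gauntlet). -/
noncomputable def gauntletProbP (E : ElimRule) {n : ℕ} (T : ProbTournament n)
    (u : Fin n) (g : Finset (Fin n)) : ℝ :=
  ∑ o : Outcome n, T.prob o * gauntletDist E n o u g

/-- Given the first-round outcome `o` and matches `M`, the probability that the gauntlet
of team `x` in the surviving probabilistic subtournament `T|_M` equals the set `g`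
(where `g` is recorded with the original team labels). -/
noncomputable def gauntletEventProb (E : ElimRule) {n : ℕ} (T : ProbTournament n)
    (M : Finset (MatchPair n)) (x : Fin n) (g : Finset (Fin n)) (o : Outcome n) : ℝ :=
  if h : x ∈ survivors o M ∧ g ⊆ survivors o M then
    gauntletProbP E (restrictProb T (survivors o M))
      (((survivors o M).orderIsoOfFin rfl).symm ⟨x, h.1⟩)
      (Finset.univ.filter (fun a =>
        (↑((survivors o M).orderIsoOfFin rfl a) : Fin n) ∈ g))
  else 0

/-! ## Randomized Death Match -/

/-- Fueled recursion for Randomized Death Match: pick one of the `n.choose 2` matches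
uniformly at random, eliminate the loser, recurse. -/
noncomputable def RDMAux : ℕ → ∀ n : ℕ, Outcome n → Fin n → ℝ
  | 0, n, _, _ => if n = 1 then 1 else 0
  | fuel + 1, n, o, i =>
    if n ≤ 1 then (if n = 1 then 1 else 0)
    else ((n.choose 2 : ℝ))⁻¹ * ∑ e : MatchPair n,
      (if h : i ∈ survivors o {e} then
        RDMAux fuel (survivors o {e}).card (restrictOutcome o (survivors o {e}))
          (((survivors o {e}).orderIsoOfFin rfl).symm ⟨i, h⟩)
      else 0)

/-- Randomized Death Match. -/
noncomputable def RDM : ∀ n : ℕ, Outcome n → Fin n → ℝ :=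
  fun n => RDMAux n n

/-! ## Randomized Single Elimination Bracket -/

/-- `nextPow2 n = 2 ^ ⌈log₂ n⌉`. -/
def nextPow2 (n : ℕ) : ℕ := 2 ^ Nat.clog 2 n

/-- Extend a tournament on `n` teams to `nextPow2 n` teams by adding dummy teams that
lose to all original teams (among themselves, the dummy with lower index wins). -/
def extendOutcome {n : ℕ} (o : Outcome n) : Outcome (nextPow2 n) :=
  fun e =>
    if h : (e.val.2 : ℕ) < n then
      Outcome.beats o ⟨(e.val.1 : ℕ), lt_trans (Fin.lt_def.mp e.2) h⟩ ⟨(e.val.2 : ℕ), h⟩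
    else true

/-- Fueled recursion for Randomized Single Elimination Bracket (after dummies have been
added): pick a uniformly random maximum matching on the remaining teams, play those
matches, eliminate all losers, recurse. -/
noncomputable def RSEBAux : ℕ → ∀ n : ℕ, Outcome n → Fin n → ℝ
  | 0, n, _, _ => if n = 1 then 1 else 0
  | fuel + 1, n, o, i =>
    if n ≤ 1 then (if n = 1 then 1 else 0)
    else
      ((Finset.univ.filter
          (fun M : Finset (MatchPair n) => IsMatchingSet M ∧ M.card = n / 2)).card : ℝ)⁻¹ *
        ∑ M ∈ Finset.univ.filter
            (fun M : Finset (MatchPair n) => IsMatchingSet M ∧ M.card = n / 2),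
          (if h : i ∈ survivors o M then
            RSEBAux fuel (survivors o M).card (restrictOutcome o (survivors o M))
              (((survivors o M).orderIsoOfFin rfl).symm ⟨i, h⟩)
          else 0)

/-- Randomized Single Elimination Bracket. -/
noncomputable def RSEB : ∀ n : ℕ, Outcome n → Fin n → ℝ :=
  fun n o i =>
    RSEBAux (nextPow2 n) (nextPow2 n) (extendOutcome o)
      (Fin.castLE (Nat.le_pow_clog one_lt_two n) i)

/-! ## Statement -/

/-- The three matches among three teams. -/
def m01 : MatchPair 3 := ⟨(0, 1), by decide⟩
def m12 : MatchPair 3 := ⟨(1, 2), by decide⟩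
def m02 : MatchPair 3 := ⟨(0, 2), by decide⟩

theorem matchPair_cases (e : MatchPair 3) : e = m01 ∨ e = m12 ∨ e = m02 := by
  obtain ⟨⟨i, j⟩, h⟩ := e
  fin_cases i <;> fin_cases j <;>
    first
    | exact absurd h (by decide)
    | simp [m01, m12, m02]

theorem univ_matchPair : (Finset.univ : Finset (MatchPair 3)) = {m01, m12, m02} := by
  ext e
  simpa using matchPair_cases e

/-- Outcome with `a`: 0 beats 1, `b`: 1 beats 2, `c`: 2 beats 0. -/
def mkO (t : Bool × Bool × Bool) : Outcome 3 :=
  fun e => if e.val.2 = 1 then t.1 else if e.val.1 = 1 then t.2.1 else !t.2.2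

def eqvO : Bool × Bool × Bool ≃ Outcome 3 where
  toFun := mkO
  invFun o := (o m01, o m12, !o m02)
  left_inv := by
    rintro ⟨a, b, c⟩
    simp [mkO, m01, m12, m02]
  right_inv := by
    intro o
    ext e
    rcases matchPair_cases e with h | h | h <;> subst h <;> simp [mkO, m01, m12, m02]

theorem sum_outcome (f : Outcome 3 → ℝ) :
    ∑ o : Outcome 3, f o = ∑ t : Bool × Bool × Bool, f (mkO t) :=
  (Fintype.sum_equiv eqvO _ _ (fun _ => rfl)).symm

theorem prob3 (T : ProbTournament 3) (a b c : Bool) :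
    T.prob (mkO (a, b, c)) = (if a then T.p 0 1 else T.p 1 0) *
      (if b then T.p 1 2 else T.p 2 1) * (if c then T.p 2 0 else T.p 0 2) := by
  unfold ProbTournament.prob
  rw [univ_matchPair, Finset.prod_insert (by simp [m01, m12, m02]),
    Finset.prod_insert (by simp [m12, m02]), Finset.prod_singleton]
  cases a <;> cases b <;> cases c <;> simp [mkO, m01, m12, m02, mul_assoc]

theorem winner_facts (r : ∀ n : ℕ, Outcome n → Fin n → ℝ) (hr : IsTournamentRule r)
    (o : Outcome 3) (i : Fin 3) (h : r 3 o i = 1) (j : Fin 3) :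
    r 3 o j = if j = i then 1 else 0 := by
  have hs := hr.2 3 (by norm_num) o
  have h0 := hr.1 3 o 0
  have h1 := hr.1 3 o 1
  have h2 := hr.1 3 o 2
  rw [Fin.sum_univ_three] at hs
  fin_cases i <;> fin_cases j <;> simp_all <;> linarith

/-- The tournament on three teams with `p 0 1 = a`, `p 1 2 = b`, `p 2 0 = c`. -/
noncomputable def mkT (a b c : ℝ) (ha : a ∈ Set.Icc (0 : ℝ) 1) (hb : b ∈ Set.Icc (0 : ℝ) 1)
    (hc : c ∈ Set.Icc (0 : ℝ) 1) : ProbTournament 3 where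
  p := ![![0, a, 1 - c], ![1 - a, 0, b], ![c, 1 - b, 0]]
  mem_Icc i j := by
    obtain ⟨a0, a1⟩ := ha
    obtain ⟨b0, b1⟩ := hb
    obtain ⟨c0, c1⟩ := hc
    fin_cases i <;> fin_cases j <;> simp <;> constructor <;> linarith
  compl i j h := by
    fin_cases i <;> fin_cases j <;> simp_all

theorem rPS_mkT (r : ∀ n : ℕ, Outcome n → Fin n → ℝ) (hr : IsTournamentRule r)
    (hcc : CondorcetConsistent r) (a b c : ℝ) (ha : a ∈ Set.Icc (0 : ℝ) 1)
    (hb : b ∈ Set.Icc (0 : ℝ) 1) (hc : c ∈ Set.Icc (0 : ℝ) 1) (i : Fin 3) :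
    rP r (mkT a b c ha hb hc) i =
      a * b * c * r 3 (mkO (true, true, true)) i
      + (1 - a) * (1 - b) * (1 - c) * r 3 (mkO (false, false, false)) i
      + a * (1 - c) * (if i = 0 then 1 else 0)
      + (1 - a) * b * (if i = 1 then 1 else 0)
      + (1 - b) * c * (if i = 2 then 1 else 0) := by
  have key : ∀ (t : Bool × Bool × Bool) (k : Fin 3),
      (∀ j : Fin 3, j ≠ k → Outcome.beats (mkO t) k j = true) →
      r 3 (mkO t) i = if i = k then 1 else 0 := fun t k h =>
    winner_facts r hr _ k (hcc 3 _ k h) i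
  have e1 := key (true, true, false) 0 (by decide)
  have e2 := key (true, false, false) 0 (by decide)
  have e3 := key (false, true, true) 1 (by decide)
  have e4 := key (false, true, false) 1 (by decide)
  have e5 := key (true, false, true) 2 (by decide)
  have e6 := key (false, false, true) 2 (by decide)
  unfold rP
  rw [sum_outcome]
  simp only [Fintype.sum_prod_type, Fintype.sum_bool, prob3, e1, e2, e3, e4, e5, e6]
  simp only [mkT, if_true, Bool.false_eq_true, if_false, Matrix.cons_val]
  ring

theorem prob_nonneg {n : ℕ} (T : ProbTournament n) (o : Outcome n) : 0 ≤ T.prob o := by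
  unfold ProbTournament.prob
  refine Finset.prod_nonneg fun e _ => ?_
  split_ifs
  · exact (T.mem_Icc _ _).1
  · exact (T.mem_Icc _ _).1

theorem prob_sum {n : ℕ} (T : ProbTournament n) : ∑ o : Outcome n, T.prob o = 1 := by
  have h := Finset.prod_univ_sum (fun _ : MatchPair n => (Finset.univ : Finset Bool))
    (fun e b => if b then T.p e.val.1 e.val.2 else T.p e.val.2 e.val.1)
  rw [Fintype.piFinset_univ] at h
  have h1 : ∏ e : MatchPair n, ∑ b : Bool,
      (if b then T.p e.val.1 e.val.2 else T.p e.val.2 e.val.1) = 1 := by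
    refine Finset.prod_eq_one fun e _ => ?_
    simpa using T.compl e.val.1 e.val.2 (ne_of_lt e.2)
  rw [h1] at h
  rw [h]
  unfold ProbTournament.prob
  refine Finset.sum_congr ?_ fun _ _ => rfl
  ext; simp

theorem rPS_nonneg (r : ∀ n : ℕ, Outcome n → Fin n → ℝ) (hr : IsTournamentRule r)
    {n : ℕ} (T : ProbTournament n) (S : Finset (Fin n)) : 0 ≤ rPS r T S :=
  Finset.sum_nonneg fun i _ => Finset.sum_nonneg fun o _ =>
    mul_nonneg (prob_nonneg T o) (hr.1 n o i)

theorem rPS_le_one (r : ∀ n : ℕ, Outcome n → Fin n → ℝ) (hr : IsTournamentRule r)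
    {n : ℕ} (T : ProbTournament n) (S : Finset (Fin n)) : rPS r T S ≤ 1 := by
  unfold rPS rP
  rw [Finset.sum_comm, ← prob_sum T]
  refine Finset.sum_le_sum fun o _ => ?_
  rw [← Finset.mul_sum]
  refine mul_le_of_le_one_right (prob_nonneg T o) ?_
  rcases Nat.eq_zero_or_pos n with h | h
  · subst h
    rw [Finset.eq_empty_of_isEmpty S]
    simp
  · rw [← hr.2 n h o]
    exact Finset.sum_le_sum_of_subset_of_nonneg (Finset.subset_univ S)
      fun i _ _ => hr.1 n o i

theorem exists_gain (ε : ℝ) (hε : ε ∈ Set.Icc (0 : ℝ) (1/2))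
    (r : ∀ n : ℕ, Outcome n → Fin n → ℝ) (hr : IsTournamentRule r)
    (hcc : CondorcetConsistent r) :
    ∃ (T T' : ProbTournament 3) (S : Finset (Fin 3)),
        WeaklyBounded ε 3 T ∧ S.card = 2 ∧ Adjacent S T T' ∧
        ε/3 + 2*ε^2/3 ≤ rPS r T' S - rPS r T S := by
  obtain ⟨h0, h1⟩ := hε
  have hq : (1/2 + ε) ∈ Set.Icc (0 : ℝ) 1 := ⟨by linarith, by linarith⟩
  have hz : (0 : ℝ) ∈ Set.Icc (0 : ℝ) 1 := ⟨le_refl _, zero_le_one⟩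
  have hW : WeaklyBounded ε 3 (mkT _ _ _ hq hq hq) := by
    intro i j h
    fin_cases i <;> fin_cases j <;> simp_all [mkT] <;> (try constructor) <;> linarith
  have hx := hr.2 3 (by norm_num) (mkO (true, true, true))
  have hy := hr.2 3 (by norm_num) (mkO (false, false, false))
  rw [Fin.sum_univ_three] at hx hy
  by_contra hcon
  push Not at hcon
  have g1 := hcon _ (mkT 0 _ _ hz hq hq) {0, 1} hW (by decide) (by
    intro i j h
    fin_cases i <;> fin_cases j <;> simp_all [mkT])
  have g2 := hcon _ (mkT _ 0 _ hq hz hq) {1, 2} hW (by decide) (by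
    intro i j h
    fin_cases i <;> fin_cases j <;> simp_all [mkT])
  have g3 := hcon _ (mkT _ _ 0 hq hq hz) {0, 2} hW (by decide) (by
    intro i j h
    fin_cases i <;> fin_cases j <;> simp_all [mkT])
  unfold rPS at g1 g2 g3
  rw [Finset.sum_pair (by decide), Finset.sum_pair (by decide)] at g1 g2 g3
  simp only [rPS_mkT r hr hcc] at g1 g2 g3
  have n02 : ¬ ((0 : Fin 3) = 2) := by decide
  have n12 : ¬ ((1 : Fin 3) = 2) := by decide
  have n01 : ¬ ((0 : Fin 3) = 1) := by decide
  have n20 : ¬ ((2 : Fin 3) = 0) := by decide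
  have n21 : ¬ ((2 : Fin 3) = 1) := by decide
  have n10 : ¬ ((1 : Fin 3) = 0) := by decide
  simp only [n02, n12, n01, n20, n21, n10, if_true, if_false] at g1 g2 g3
  have hx' : r 3 (mkO (true, true, true)) 2 =
    1 - r 3 (mkO (true, true, true)) 0 - r 3 (mkO (true, true, true)) 1 := by linarith
  have hy' : r 3 (mkO (false, false, false)) 2 =
    1 - r 3 (mkO (false, false, false)) 0 - r 3 (mkO (false, false, false)) 1 := by linarith
  rw [hx', hy'] at g2 g3
  have := add_lt_add (add_lt_add g1 g2) g3
  ring_nf at this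
  linarith

theorem stmt6 (ε : ℝ) (hε : ε ∈ Set.Icc (0 : ℝ) (1/2))
    (r : ∀ n : ℕ, Outcome n → Fin n → ℝ) (hr : IsTournamentRule r)
    (hcc : CondorcetConsistent r) :
    ε/3 + 2*ε^2/3 ≤ alph r 2 (WeaklyBounded ε)
    ∧ ∃ (T T' : ProbTournament 3) (S : Finset (Fin 3)),
        WeaklyBounded ε 3 T ∧ S.card = 2 ∧ Adjacent S T T' ∧
        ε/3 + 2*ε^2/3 ≤ rPS r T' S - rPS r T S := by
  have hex := exists_gain ε hε r hr hcc
  refine ⟨?_, hex⟩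
  obtain ⟨T, T', S, hW, hS, hA, hg⟩ := hex
  refine le_trans hg (le_csSup ⟨1, ?_⟩ ⟨3, T, T', S, hW, hS.le, hA, rfl⟩)
  rintro x ⟨n, U, U', R, -, -, -, rfl⟩
  linarith [rPS_nonneg r hr U R, rPS_le_one r hr U' R]
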